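/- Let Γ ∈ Matrix (Fin 2) (Fin 2) ℂ be Hermitian positive definite and let f°(z) := (π² · det Γ)⁻¹ · exp(−zᴴ Γ⁻¹ z) for z ∈ ℂ² (the proper, mean-zero complex Gaussian density; det Γ and the quadratic form zᴴ Γ⁻¹ z are positive reals). Then the pushforward, under the almost-everywhere defined map (z₁, z₂) ↦ z₂/z₁, of the measure on ℂ² having density f° with respect to Lebesgue measure equals the measure on ℂ having density f_{Q°}(q) := (π · det Γ)⁻¹ · (𝐪ᴴ Γ⁻¹ 𝐪)⁻² with respect to Lebesgue measure, where 𝐪 := (1, q)ᵀ ∈ ℂ². (Special case C = 0, μ = 0 of the paper's quotient-density theorem.) -/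

import Mathlib

open MeasureTheory Matrix Complex Real
open scoped ComplexOrder

noncomputable section

/-- The vector `𝐪 = (1, q)ᵀ ∈ ℂ²`. -/
def qvec (q : ℂ) : Fin 2 → ℂ := ![1, q]

/-- The proper, mean-zero complex Gaussian density with covariance `Γ`:
`f°(z) = (π²·det Γ)⁻¹ · exp(−zᴴ Γ⁻¹ z)`. -/
def properGaussDensity (Γ : Matrix (Fin 2) (Fin 2) ℂ) (z : Fin 2 → ℂ) : ℝ :=
  (Real.pi ^ 2 * Γ.det.re)⁻¹ * Real.exp (-(star z ⬝ᵥ (Γ⁻¹ *ᵥ z)).re)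

theorem lintegral_eq_normSq_mul_lintegral_comp_mul {w : ℂ} (hw : w ≠ 0)
    {g : ℂ → ENNReal} (hg : Measurable g) :
    ∫⁻ z, g z = ENNReal.ofReal (normSq w) * ∫⁻ q, g (w * q) := by
  have hdet : LinearMap.det (LinearMap.mul ℝ ℂ w) = normSq w := by
    rw [← Algebra.norm_complex_apply, Algebra.norm_apply]
    rfl
  have hpos : 0 < normSq w := normSq_pos.mpr hw
  have hmap : Measure.map (fun q => w * q) volume = _ := Measure.map_linearMap_addHaar_eq_smul_addHaar (volume : Measure ℂ)
    (f := LinearMap.mul ℝ ℂ w) (by rw [hdet]; exact hpos.ne')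
  have hcomp : ∫⁻ q, g (w * q) = ENNReal.ofReal (normSq w)⁻¹ * ∫⁻ z, g z := by
    rw [hdet, abs_of_pos (inv_pos.mpr hpos)] at hmap
    rw [← smul_eq_mul, ← lintegral_smul_measure, ← hmap,
      lintegral_map hg (measurable_const_mul w)]
  rw [hcomp, ← mul_assoc, ← ENNReal.ofReal_mul hpos.le, mul_inv_cancel₀ hpos.ne',
    ENNReal.ofReal_one, one_mul]

theorem lintegral_fin_two_eq_lintegral_quotient {G : (Fin 2 → ℂ) → ENNReal}
    (hG : Measurable G) :
    ∫⁻ z, G z = ∫⁻ q : ℂ, ∫⁻ w : ℂ, ENNReal.ofReal (normSq w) * G (w • qvec q) := by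
  have hvec : Measurable fun p : ℂ × ℂ => (![p.1, p.2] : Fin 2 → ℂ) := by
    rw [measurable_pi_iff]
    intro i
    fin_cases i
    · exact measurable_fst
    · exact measurable_snd
  have hsmul : ∀ w q : ℂ, w • qvec q = ![w, w * q] := by
    intro w q
    ext i
    fin_cases i <;> simp [qvec]
  have hpair : ∫⁻ z, G z = ∫⁻ p : ℂ × ℂ, G ![p.1, p.2] :=
    ((volume_preserving_finTwoArrow ℂ).symm.lintegral_comp hG).symm
  have hnormSq : Measurable fun w : ℂ => ENNReal.ofReal (normSq w) :=
    ENNReal.measurable_ofReal.comp Complex.continuous_normSq.measurable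
  have hmeas : Measurable fun p : ℂ × ℂ =>
      ENNReal.ofReal (normSq p.1) * G ![p.1, p.1 * p.2] :=
    (hnormSq.comp measurable_fst).mul
      (hG.comp (hvec.comp (measurable_fst.prodMk (measurable_fst.mul measurable_snd))))
  simp_rw [hsmul]
  rw [hpair, Measure.volume_eq_prod, lintegral_prod (fun p : ℂ × ℂ => G ![p.1, p.2]) (hG.comp hvec).aemeasurable,
    lintegral_lintegral_swap
      (f := fun q w : ℂ => ENNReal.ofReal (normSq w) * G ![w, w * q])
      (hmeas.comp measurable_swap).aemeasurable]
  refine lintegral_congr_ae ?_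
  filter_upwards [compl_mem_ae_iff.mpr (measure_singleton (0 : ℂ))] with w hw
  have hGw : Measurable fun z : ℂ => G ![w, z] := hG.comp (hvec.comp measurable_prodMk_left)
  rw [lintegral_const_mul' _ _ ENNReal.ofReal_ne_top]
  exact lintegral_eq_normSq_mul_lintegral_comp_mul hw hGw

theorem map_quotient_withDensity {F : (Fin 2 → ℂ) → ENNReal} (hF : Measurable F) :
    Measure.map (fun z : Fin 2 → ℂ => z 1 / z 0) (volume.withDensity F) =
      volume.withDensity
        (fun q => ∫⁻ w : ℂ, ENNReal.ofReal (normSq w) * F (w • qvec q)) := by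
  have hdiv : Measurable fun z : Fin 2 → ℂ => z 1 / z 0 :=
    (measurable_pi_apply 1).div (measurable_pi_apply 0)
  ext s hs
  rw [Measure.map_apply hdiv hs, withDensity_apply _ (hdiv hs), withDensity_apply _ hs,
    ← lintegral_indicator (hdiv hs), ← lintegral_indicator hs,
    lintegral_fin_two_eq_lintegral_quotient (hF.indicator (hdiv hs))]
  refine lintegral_congr fun q => ?_
  have hquot : ∀ w : ℂ, w ≠ 0 → (w • qvec q) 1 / (w • qvec q) 0 = q := by
    intro w hw
    simp [qvec, hw]
  by_cases hq : q ∈ s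
  · rw [Set.indicator_of_mem hq]
    refine lintegral_congr fun w => ?_
    rcases eq_or_ne w 0 with rfl | hw
    · simp
    · rw [Set.indicator_of_mem]
      rwa [Set.mem_preimage, hquot w hw]
  · rw [Set.indicator_of_notMem hq]
    refine (lintegral_congr fun w => ?_).trans lintegral_zero
    rcases eq_or_ne w 0 with rfl | hw
    · simp
    · rw [Set.indicator_of_notMem, mul_zero]
      rwa [Set.mem_preimage, hquot w hw]

theorem lintegral_normSq_mul_exp_neg_mul_normSq {a : ℝ} (ha : 0 < a) :
    ∫⁻ w : ℂ, ENNReal.ofReal (normSq w * Real.exp (-(a * normSq w))) =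
      ENNReal.ofReal (Real.pi * (a ^ 2)⁻¹) := by
  have hint : ∫ w : ℂ, normSq w * Real.exp (-(a * normSq w)) = Real.pi * (a ^ 2)⁻¹ := by
    have h := Complex.integral_rpow_mul_exp_neg_mul_rpow (p := 2) (q := 2) (b := a)
      (by norm_num) (by norm_num) ha
    have hexp : (-(2 + 2) / 2 : ℝ) = -(2 : ℕ) := by norm_num
    have hgam : ((2 + 2) / 2 : ℝ) = 2 := by norm_num
    rw [hexp, hgam, Real.Gamma_two, Real.rpow_neg ha.le, Real.rpow_natCast] at h
    simp only [Real.rpow_two, ← Complex.normSq_eq_norm_sq, neg_mul] at h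
    rw [h]
    ring
  have hintegrable : Integrable fun w : ℂ => normSq w * Real.exp (-(a * normSq w)) := by
    refine not_imp_comm.mp integral_undef ?_
    rw [hint]
    positivity
  rw [← hint, ofReal_integral_eq_lintegral_ofReal hintegrable]
  exact Filter.Eventually.of_forall fun w => mul_nonneg (normSq_nonneg w) (Real.exp_nonneg _)

theorem star_smul_dotProduct_mulVec_smul {n : Type*} [Fintype n] (A : Matrix n n ℂ) (w : ℂ)
    (v : n → ℂ) :
    (star (w • v) ⬝ᵥ (A *ᵥ (w • v))).re = normSq w * (star v ⬝ᵥ (A *ᵥ v)).re := by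
  rw [star_smul, mulVec_smul, smul_dotProduct, dotProduct_smul, smul_smul, smul_eq_mul,
    Complex.star_def, ← Complex.normSq_eq_conj_mul_self, Complex.re_ofReal_mul]

theorem continuous_properGaussDensity (Γ : Matrix (Fin 2) (Fin 2) ℂ) :
    Continuous (properGaussDensity Γ) := by
  unfold properGaussDensity
  fun_prop

/-- **Quotient density in the proper, mean-zero case.**
For `Γ` Hermitian positive definite, the pushforward of the measure with density `f°` under
the (a.e. defined) map `(z₁, z₂) ↦ z₂/z₁` is the measure on `ℂ` with density
`f_{Q°}(q) = (π·det Γ)⁻¹·(𝐪ᴴ Γ⁻¹ 𝐪)⁻²`. -/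
theorem proper_gaussian_quotient_density
    (Γ : Matrix (Fin 2) (Fin 2) ℂ) (hΓ : Γ.PosDef) :
    Measure.map (fun z : Fin 2 → ℂ => z 1 / z 0)
        ((volume : Measure (Fin 2 → ℂ)).withDensity
          (fun z => ENNReal.ofReal (properGaussDensity Γ z))) =
      (volume : Measure ℂ).withDensity
        (fun q => ENNReal.ofReal
          ((Real.pi * Γ.det.re)⁻¹ * ((star (qvec q) ⬝ᵥ (Γ⁻¹ *ᵥ qvec q)).re ^ 2)⁻¹)) := by
  have hdet : 0 < Γ.det.re := (Complex.pos_iff.mp hΓ.det_pos).1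
  rw [map_quotient_withDensity (continuous_properGaussDensity Γ).measurable.ennreal_ofReal]
  congr 1
  funext q
  have hne : qvec q ≠ 0 := fun h => one_ne_zero (congrFun h 0)
  have ha : 0 < (star (qvec q) ⬝ᵥ (Γ⁻¹ *ᵥ qvec q)).re :=
    hΓ.inv.re_dotProduct_pos hne
  have hintegrand : ∀ w : ℂ, ENNReal.ofReal (normSq w) *
      ENNReal.ofReal (properGaussDensity Γ (w • qvec q)) =
      ENNReal.ofReal (Real.pi ^ 2 * Γ.det.re)⁻¹ * ENNReal.ofReal (normSq w *
        Real.exp (-((star (qvec q) ⬝ᵥ (Γ⁻¹ *ᵥ qvec q)).re * normSq w))) := by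
    intro w
    rw [← ENNReal.ofReal_mul (normSq_nonneg w), ← ENNReal.ofReal_mul (by positivity),
      properGaussDensity, star_smul_dotProduct_mulVec_smul,
      mul_comm (normSq w) (star (qvec q) ⬝ᵥ _).re, mul_left_comm]
  simp_rw [hintegrand]
  rw [lintegral_const_mul' _ _ ENNReal.ofReal_ne_top,
    lintegral_normSq_mul_exp_neg_mul_normSq ha, ← ENNReal.ofReal_mul (by positivity)]
  congr 1
  field_simp

end
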